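/- arXiv:2110.00316 — 3 statements merged into one kernel-verified Lean document; each statement's English description precedes it below -/
import Mathlib

section
/- (Failure of Barbara with two weak assertoric premises, A^◆A^◆A^◆: the problem of joint possibility.) There exist a type I of individuals, a nonempty set V of states, and term-extensions A, B, C over V such that there is a state v with A v ⊆ B v, and there is a state w with B w ⊆ C w, but there is no state u with A u ⊆ C u. -/
/-- Failure of Barbara with two weak assertoric premises (A^◆A^◆A^◆):
the problem of joint possibility. -/
theorem stmt_7 :
    ∃ (I V : Type) (_ : Nonempty V) (A B C : V → Set I),
      (∃ v : V, A v ⊆ B v) ∧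
      (∃ w : V, B w ⊆ C w) ∧
      ¬ ∃ u : V, A u ⊆ C u := by
  refine ⟨Unit, Bool, ⟨true⟩, fun _ => Set.univ, fun v => {_x | v = true}, fun _ => ∅,
    ⟨true, fun _ _ => rfl⟩, ⟨false, fun _ h => Bool.false_ne_true h⟩, ?_⟩
  rintro ⟨_, h⟩
  exact h (Set.mem_univ ())
end

section
/- (Validity of the first-figure mood EⁿAᶜE with assertoric conclusion.) For all term-extensions A, B, C over a nonempty set of states V: if 'B → □(Aᶜ)' holds (B v ⊆ □(Aᶜ) for every v) and 'C → ⊖B' holds (C v ⊆ ⊖B for every v), then 'C → Aᶜ' holds (C v ⊆ I \ A v for every v). -/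
/-- Validity of the first-figure mood EⁿAᶜE with assertoric conclusion:
from `B → □(Aᶜ)` and `C → ⊖B` infer `C → Aᶜ`. -/
theorem stmt_13 {I V : Type*} [Nonempty V] (A B C : V → Set I)
    (h1 : ∀ v : V, B v ⊆ ⋂ w : V, (A w)ᶜ)
    (h2 : ∀ v : V, C v ⊆ (⋃ w : V, B w) ∩ (⋃ w : V, (B w)ᶜ)) :
    ∀ v : V, C v ⊆ (A v)ᶜ := by
  intro v x hx
  obtain ⟨w, hw⟩ := Set.mem_iUnion.mp (h2 v hx).1
  exact Set.mem_iInter.mp (h1 w hw) v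
end

section
/- (Invalidity of the third-figure mood EAⁿOⁿ: explicit countermodel.) There exist a type I of individuals, a nonempty set V of states, and term-extensions A, B, C over V such that 'C → Aᶜ' holds (C v ⊆ I \ A v for every v) and 'C → □B' holds (C v ⊆ □B for every v), but 'B ⇝ □(Aᶜ)' fails (for some v ∈ V, B v ∩ □(Aᶜ) = ∅). -/
/-- Invalidity of the third-figure mood EAⁿOⁿ: explicit countermodel where
`C → Aᶜ` and `C → □B` hold but `B ⇝ □(Aᶜ)` fails. -/
theorem stmt_18 :
    ∃ (I V : Type) (_ : Nonempty V) (A B C : V → Set I),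
      (∀ v : V, C v ⊆ (A v)ᶜ) ∧
      (∀ v : V, C v ⊆ ⋂ w : V, B w) ∧
      (∃ v : V, B v ∩ (⋂ w : V, (A w)ᶜ) = ∅) := by
  refine ⟨Bool, Bool, ⟨true⟩, fun v => {v}, fun _ => Set.univ, fun v => {!v}, ?_, ?_, true, ?_⟩
  · simp
  · simp
  · ext x
    simp
end
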